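/- arXiv:0909.1596 — 2 statements merged into one kernel-verified Lean document; each statement's English description precedes it below -/
import Mathlib

section
/- If there is no subspace S of ℂ^N with {0} ≠ S ≠ ℂ^N that is invariant under every Lindblad operator V_d, then the Lindblad generator has a unique steady state, and this steady state is positive definite (i.e., it lies in the interior of the set of density matrices). -/
open Matrix
open scoped ComplexOrder

/-- The Lindblad generator `𝓛(ρ) = -i[H,ρ] + Σ_d (V_d ρ V_d† - ½(V_d† V_d ρ + ρ V_d† V_d))`. -/
noncomputable def lindblad {n : Type*} [Fintype n] [DecidableEq n] {ι : Type*} [Fintype ι]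
    (H : Matrix n n ℂ) (V : ι → Matrix n n ℂ) (ρ : Matrix n n ℂ) : Matrix n n ℂ :=
  -Complex.I • (H * ρ - ρ * H) +
    ∑ d, (V d * ρ * (V d)ᴴ - (1 / 2 : ℂ) • ((V d)ᴴ * V d * ρ + ρ * ((V d)ᴴ * V d)))

/-- A density matrix: positive semidefinite with trace one. -/
def IsDensityMatrix {n : Type*} [Fintype n] (ρ : Matrix n n ℂ) : Prop :=
  ρ.PosSemidef ∧ ρ.trace = 1

/-- A steady state of the Lindblad dynamics. -/
noncomputable def IsSteadyState {n : Type*} [Fintype n] [DecidableEq n] {ι : Type*} [Fintype ι]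
    (H : Matrix n n ℂ) (V : ι → Matrix n n ℂ) (ρ : Matrix n n ℂ) : Prop :=
  IsDensityMatrix ρ ∧ lindblad H V ρ = 0

/-- The support of a matrix: its range as a linear map `ℂ^N → ℂ^N`. -/
noncomputable def matSupport {n : Type*} [Fintype n] (ρ : Matrix n n ℂ) :
    Submodule ℂ (n → ℂ) :=
  LinearMap.range ρ.mulVecLin

/-- An extremal steady state: it cannot be written as a nontrivial convex combination
of two steady states other than itself. -/
noncomputable def IsExtremalSteadyState {n : Type*} [Fintype n] [DecidableEq n]
    {ι : Type*} [Fintype ι]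
    (H : Matrix n n ℂ) (V : ι → Matrix n n ℂ) (ρ : Matrix n n ℂ) : Prop :=
  IsSteadyState H V ρ ∧
    ∀ (a : ℝ) (ρ₁ ρ₂ : Matrix n n ℂ), 0 < a → a < 1 →
      IsSteadyState H V ρ₁ → IsSteadyState H V ρ₂ →
      ρ = a • ρ₁ + (1 - a) • ρ₂ → ρ₁ = ρ ∧ ρ₂ = ρ

section LindbladKernel

variable {n : Type*} [Fintype n]

/-- The rates of a classical master equation vanish between the nonpositive part and the positive
part of a stationary real vector. -/
theorem rate_eq_zero_of_stationary {R : n → n → ℝ} (hR : ∀ i j, 0 ≤ R i j) {l : n → ℝ}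
    (h : ∀ i, ∑ j, R i j * l j = l i * ∑ k, R k i) {i j : n} (hi : l i ≤ 0) (hj : 0 < l j) :
    R i j = 0 := by
  let s : n → ℝ := fun i => if 0 < l i then 1 else 0
  have hsum : ∑ p : n × n, (s p.2 - s p.1) * l p.2 * R p.1 p.2 = 0 := by
    have h1 : ∑ i, ∑ j, s i * (R i j * l j) = ∑ i, ∑ j, s j * (l j * R i j) := by
      rw [Finset.sum_comm (f := fun i j => s j * (l j * R i j))]
      exact Finset.sum_congr rfl fun i _ => by simp only [← Finset.mul_sum, h]
    rw [Fintype.sum_prod_type, ← sub_eq_zero.mpr h1.symm]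
    simp only [← Finset.sum_sub_distrib]
    exact Finset.sum_congr rfl fun i _ => Finset.sum_congr rfl fun j _ => by ring
  have hnonneg : ∀ p ∈ Finset.univ (α := n × n), 0 ≤ (s p.2 - s p.1) * l p.2 * R p.1 p.2 := by
    intro p _
    refine mul_nonneg ?_ (hR _ _)
    by_cases h1 : 0 < l p.1 <;> by_cases h2 : 0 < l p.2 <;> simp only [s, h1, h2] <;>
      norm_num <;> linarith
  have := (Finset.sum_eq_zero_iff_of_nonneg hnonneg).mp hsum (i, j) (Finset.mem_univ _)
  simpa [s, hj, hj.ne', hi.not_gt] using this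

variable [DecidableEq n] {ι : Type*} [Fintype ι]

/-- The Lindblad generator as a `ℂ`-linear map. -/
noncomputable def lindbladLinearMap (H : Matrix n n ℂ) (V : ι → Matrix n n ℂ) :
    Matrix n n ℂ →ₗ[ℂ] Matrix n n ℂ where
  toFun := lindblad H V
  map_add' ρ σ := by
    simp only [lindblad, Matrix.mul_add, Matrix.add_mul, smul_add, Finset.sum_add_distrib,
      Finset.sum_sub_distrib, smul_sub]
    abel
  map_smul' c ρ := by
    simp only [lindblad, Matrix.mul_smul, Matrix.smul_mul, smul_add, Finset.smul_sum, smul_sub,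
      RingHom.id_apply, smul_comm c]

theorem trace_lindblad (H : Matrix n n ℂ) (V : ι → Matrix n n ℂ) (ρ : Matrix n n ℂ) :
    (lindblad H V ρ).trace = 0 := by
  have hH : (H * ρ - ρ * H).trace = 0 := by rw [trace_sub, trace_mul_comm, sub_self]
  have hV (d : ι) : (V d * ρ * (V d)ᴴ -
      (1 / 2 : ℂ) • ((V d)ᴴ * V d * ρ + ρ * ((V d)ᴴ * V d))).trace = 0 := by
    rw [trace_sub, trace_smul, trace_add, trace_mul_comm ρ, trace_mul_comm (V d * ρ),
      ← Matrix.mul_assoc, smul_eq_mul]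
    ring
  simp only [lindblad, trace_add, trace_smul, hH, trace_sum, hV, smul_zero, Finset.sum_const_zero,
    add_zero]

theorem conjTranspose_lindblad {H : Matrix n n ℂ} (hH : H.IsHermitian) (V : ι → Matrix n n ℂ)
    (ρ : Matrix n n ℂ) : (lindblad H V ρ)ᴴ = lindblad H V ρᴴ := by
  simp only [lindblad, conjTranspose_add, conjTranspose_sub, conjTranspose_smul, conjTranspose_sum,
    conjTranspose_mul, conjTranspose_conjTranspose, hH.eq, Matrix.mul_assoc]
  congr 1
  · simp [← smul_neg]
  · simp [add_comm]

/-- The Lindblad generator is covariant under unitary changes of basis. -/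
theorem lindblad_conj (H : Matrix n n ℂ) (V : ι → Matrix n n ℂ) (ρ : Matrix n n ℂ)
    {U : Matrix n n ℂ} (hU : U * Uᴴ = 1) :
    lindblad (Uᴴ * H * U) (fun d => Uᴴ * V d * U) (Uᴴ * ρ * U) = Uᴴ * lindblad H V ρ * U := by
  have key (A B : Matrix n n ℂ) : Uᴴ * A * U * (Uᴴ * B * U) = Uᴴ * (A * B) * U := by
    calc _ = Uᴴ * A * (U * Uᴴ) * B * U := by simp only [Matrix.mul_assoc]
      _ = _ := by rw [hU]; simp only [Matrix.mul_assoc, Matrix.one_mul]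
  have hstar (A : Matrix n n ℂ) : (Uᴴ * A * U)ᴴ = Uᴴ * Aᴴ * U := by
    simp only [conjTranspose_mul, conjTranspose_conjTranspose, Matrix.mul_assoc]
  simp only [lindblad, hstar, key, Matrix.mul_add, Matrix.add_mul, Matrix.mul_sub, Matrix.sub_mul,
    Matrix.mul_smul, Matrix.smul_mul, Matrix.mul_sum, Matrix.sum_mul]

/-- On diagonal matrices, the diagonal of the Lindblad equation is a classical master equation
with transition rates `∑ d, ‖V d i j‖²`. -/
theorem lindblad_diagonal_apply_self (H : Matrix n n ℂ) (V : ι → Matrix n n ℂ) (l : n → ℝ)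
    (i : n) :
    lindblad H V (diagonal fun j => (l j : ℂ)) i i =
      ((∑ j, (∑ d, ‖V d i j‖ ^ 2) * l j - l i * ∑ k, ∑ d, ‖V d k i‖ ^ 2 : ℝ) : ℂ) := by
  have h1 (d : ι) : (V d * diagonal (fun j => (l j : ℂ)) * (V d)ᴴ) i i =
      ∑ j, (‖V d i j‖ : ℂ) ^ 2 * l j := by
    rw [Matrix.mul_apply]
    refine Finset.sum_congr rfl fun j _ => ?_
    rw [mul_diagonal, conjTranspose_apply, ← Complex.mul_conj']
    simp only [RCLike.star_def]
    ring
  have h2 (d : ι) : ((V d)ᴴ * V d) i i = ∑ k, (‖V d k i‖ : ℂ) ^ 2 := by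
    rw [Matrix.mul_apply]
    refine Finset.sum_congr rfl fun k _ => ?_
    rw [conjTranspose_apply, ← Complex.conj_mul']
    rfl
  have hcomm : ∑ j, (∑ d, ‖V d i j‖ ^ 2) * l j = ∑ d, ∑ j, ‖V d i j‖ ^ 2 * l j := by
    simp only [Finset.sum_mul]
    exact Finset.sum_comm
  rw [hcomm, Finset.sum_comm (f := fun k d => ‖V d k i‖ ^ 2), Finset.mul_sum,
    ← Finset.sum_sub_distrib]
  simp only [lindblad, Matrix.add_apply, Matrix.smul_apply, Matrix.sub_apply, Matrix.sum_apply,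
    h1, mul_diagonal, diagonal_mul, h2, mul_comm (H i i), sub_self, smul_zero, zero_add]
  push_cast
  refine Finset.sum_congr rfl fun d _ => ?_
  rw [smul_eq_mul]
  ring

/-- A Hermitian matrix in the kernel of an irreducible Lindblad generator is either positive
definite or negative semidefinite. -/
theorem posDef_or_neg_posSemidef_of_lindblad_eq_zero {H : Matrix n n ℂ} {V : ι → Matrix n n ℂ}
    (hirr : ∀ S : Submodule ℂ (n → ℂ), (∀ d, ∀ x ∈ S, V d *ᵥ x ∈ S) → S = ⊥ ∨ S = ⊤)
    {σ : Matrix n n ℂ} (hσ : σ.IsHermitian) (h0 : lindblad H V σ = 0) :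
    σ.PosDef ∨ (-σ).PosSemidef := by
  let U : Matrix n n ℂ := hσ.eigenvectorUnitary
  let l : n → ℝ := hσ.eigenvalues
  have hU : U * Uᴴ = 1 := Unitary.mul_star_self_of_mem hσ.eigenvectorUnitary.2
  have hU' : Uᴴ * U = 1 := Unitary.star_mul_self_of_mem hσ.eigenvectorUnitary.2
  have hspec : σ = U * diagonal (fun j => (l j : ℂ)) * Uᴴ := hσ.spectral_theorem
  have hdiag : Uᴴ * σ * U = diagonal fun j => (l j : ℂ) := by
    rw [hspec]
    calc _ = (Uᴴ * U) * diagonal (fun j => (l j : ℂ)) * (Uᴴ * U) := by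
          simp only [Matrix.mul_assoc]
      _ = _ := by rw [hU', Matrix.one_mul, Matrix.mul_one]
  let W : ι → Matrix n n ℂ := fun d => Uᴴ * V d * U
  have hW (d : ι) (i j : n) (hi : l i ≤ 0) (hj : 0 < l j) : W d i j = 0 := by
    have hst (i : n) : ∑ j, (∑ d, ‖W d i j‖ ^ 2) * l j = l i * ∑ k, ∑ d, ‖W d k i‖ ^ 2 := by
      have h := lindblad_diagonal_apply_self (Uᴴ * H * U) W l i
      rw [← hdiag, lindblad_conj H V σ hU, h0, Matrix.mul_zero, Matrix.zero_mul,
        Matrix.zero_apply] at h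
      exact sub_eq_zero.mp (by exact_mod_cast h.symm)
    have h := rate_eq_zero_of_stationary (R := fun i j => ∑ d, ‖W d i j‖ ^ 2)
      (fun i j => by positivity) hst hi hj
    have := (Finset.sum_eq_zero_iff_of_nonneg fun d _ => by positivity).mp h d (Finset.mem_univ d)
    simpa using this
  let S : Submodule ℂ (n → ℂ) :=
    { carrier := {x | ∀ i, l i ≤ 0 → (Uᴴ *ᵥ x) i = 0}
      add_mem' := fun hx hy i hi => by simp [mulVec_add, hx i hi, hy i hi]
      zero_mem' := fun i _ => by simp
      smul_mem' := fun c x hx i hi => by simp [mulVec_smul, hx i hi] }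
  have hUe (i : n) : Uᴴ *ᵥ (U *ᵥ Pi.single i 1) = Pi.single i 1 := by
    rw [mulVec_mulVec, hU', one_mulVec]
  have hinv (d : ι) (x : n → ℂ) (hx : x ∈ S) : V d *ᵥ x ∈ S := by
    intro i hi
    have : Uᴴ *ᵥ (V d *ᵥ x) = W d *ᵥ (Uᴴ *ᵥ x) := by
      simp only [W, mulVec_mulVec, Matrix.mul_assoc, hU, Matrix.mul_one]
    rw [this]
    refine Finset.sum_eq_zero fun j _ => ?_
    rcases le_or_gt (l j) 0 with hj | hj
    · exact mul_eq_zero_of_right _ (hx j hj)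
    · exact mul_eq_zero_of_left (hW d i j hi hj) _
  rcases hirr S hinv with hS | hS
  · right
    have hl (i : n) : l i ≤ 0 := by
      by_contra hi
      have hmem : U *ᵥ Pi.single i 1 ∈ S := by
        intro j hj
        rw [hUe, Pi.single_eq_of_ne]
        rintro rfl
        exact hi hj
      rw [hS, Submodule.mem_bot] at hmem
      simpa [hmem] using congrFun (hUe i) i
    have : -σ = U * diagonal (fun j => ((-l j : ℝ) : ℂ)) * Uᴴ := by
      simp only [Complex.ofReal_neg, ← diagonal_neg, Matrix.mul_neg, Matrix.neg_mul]
      exact congrArg Neg.neg hspec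
    rw [this]
    refine PosSemidef.mul_mul_conjTranspose_same (posSemidef_diagonal_iff.mpr fun i => ?_) U
    exact_mod_cast neg_nonneg.mpr (hl i)
  · left
    rw [hσ.posDef_iff_eigenvalues_pos]
    intro i
    by_contra hi
    have hmem : U *ᵥ Pi.single i 1 ∈ S := hS ▸ Submodule.mem_top
    have := hmem i (not_lt.mp hi)
    rw [hUe, Pi.single_eq_same] at this
    exact one_ne_zero this

theorem exists_isHermitian_ne_zero_lindblad_eq_zero [Nonempty n] {H : Matrix n n ℂ}
    (hH : H.IsHermitian) (V : ι → Matrix n n ℂ) :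
    ∃ σ : Matrix n n ℂ, σ.IsHermitian ∧ σ ≠ 0 ∧ lindblad H V σ = 0 := by
  let L := lindbladLinearMap H V
  have hinj : ¬ Function.Injective L := by
    intro h
    obtain ⟨ρ, hρ⟩ := LinearMap.injective_iff_surjective.mp h 1
    have := trace_lindblad H V ρ
    rw [show lindblad H V ρ = 1 from hρ, trace_one] at this
    simp at this
  rw [← LinearMap.ker_eq_bot, Submodule.eq_bot_iff] at hinj
  push Not at hinj
  obtain ⟨X, hX, hX0⟩ := hinj
  replace hX : L X = 0 := hX
  have hX' : L Xᴴ = 0 := by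
    change lindblad H V Xᴴ = 0
    rw [← conjTranspose_lindblad hH, show lindblad H V X = 0 from hX, conjTranspose_zero]
  by_cases h : X + Xᴴ = 0
  · have hneg : Xᴴ = -X := (neg_eq_of_add_eq_zero_right h).symm
    refine ⟨Complex.I • X, ?_, smul_ne_zero Complex.I_ne_zero hX0, ?_⟩
    · simp [Matrix.IsHermitian, conjTranspose_smul, hneg]
    · change L (Complex.I • X) = 0
      rw [map_smul, hX, smul_zero]
  · refine ⟨X + Xᴴ, ?_, h, ?_⟩
    · simp [Matrix.IsHermitian, add_comm]
    · change L (X + Xᴴ) = 0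
      rw [map_add, hX, hX', add_zero]

theorem IsSteadyState.normalize {H : Matrix n n ℂ} {V : ι → Matrix n n ℂ} {σ : Matrix n n ℂ}
    (hσ : σ.PosSemidef) (hne : σ ≠ 0) (h0 : lindblad H V σ = 0) :
    IsSteadyState H V (σ.trace⁻¹ • σ) := by
  have htr : σ.trace ≠ 0 := fun h => hne (hσ.trace_eq_zero_iff.mp h)
  refine ⟨⟨hσ.smul (inv_nonneg.mpr hσ.trace_nonneg), ?_⟩, ?_⟩
  · rw [trace_smul, smul_eq_mul, inv_mul_cancel₀ htr]
  · change lindbladLinearMap H V _ = 0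
    rw [map_smul, show lindbladLinearMap H V σ = 0 from h0, smul_zero]

end LindbladKernel

/-- If no proper nonzero subspace of `ℂ^N` is invariant under every Lindblad operator,
then there is a unique steady state, and it is positive definite (in the interior). -/
theorem unique_interior_steady_state_of_no_proper_invariant_subspace
    (N : ℕ) (hN : 1 ≤ N)
    (H : Matrix (Fin N) (Fin N) ℂ) (hH : H.IsHermitian)
    {ι : Type*} [Fintype ι] (V : ι → Matrix (Fin N) (Fin N) ℂ)
    (hno : ¬ ∃ S : Submodule ℂ (Fin N → ℂ), S ≠ ⊥ ∧ S ≠ ⊤ ∧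
      ∀ d : ι, ∀ x ∈ S, (V d).mulVec x ∈ S) :
    ∃ ρ : Matrix (Fin N) (Fin N) ℂ, IsSteadyState H V ρ ∧ ρ.PosDef ∧
      ∀ σ : Matrix (Fin N) (Fin N) ℂ, IsSteadyState H V σ → σ = ρ := by
  have : Nonempty (Fin N) := ⟨⟨0, hN⟩⟩
  have hirr (S : Submodule ℂ (Fin N → ℂ)) (hS : ∀ d, ∀ x ∈ S, V d *ᵥ x ∈ S) :
      S = ⊥ ∨ S = ⊤ := by
    by_contra! h
    exact hno ⟨S, h.1, h.2, hS⟩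
  obtain ⟨σ, hσ, hne, h0⟩ := exists_isHermitian_ne_zero_lindblad_eq_zero hH V
  obtain ⟨ρ, hρ⟩ : ∃ ρ, IsSteadyState H V ρ := by
    rcases posDef_or_neg_posSemidef_of_lindblad_eq_zero hirr hσ h0 with h | h
    · exact ⟨_, .normalize h.posSemidef hne h0⟩
    · refine ⟨_, .normalize h (neg_ne_zero.mpr hne) ?_⟩
      change lindbladLinearMap H V _ = 0
      rw [map_neg, show lindbladLinearMap H V σ = 0 from h0, neg_zero]
  have hρne : ρ ≠ 0 := by
    rintro rfl
    simpa using hρ.1.2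
  refine ⟨ρ, hρ, ?_, fun τ hτ => ?_⟩
  · refine (posDef_or_neg_posSemidef_of_lindblad_eq_zero hirr hρ.1.1.isHermitian hρ.2).resolve_right
      fun h => ?_
    have := h.trace_nonneg
    rw [trace_neg, hρ.1.2] at this
    norm_num at this
  · have htr : (τ - ρ).trace = 0 := by rw [trace_sub, hτ.1.2, hρ.1.2, sub_self]
    have hker : lindblad H V (τ - ρ) = 0 := by
      change lindbladLinearMap H V _ = 0
      rw [map_sub, show lindbladLinearMap H V τ = 0 from hτ.2,
        show lindbladLinearMap H V ρ = 0 from hρ.2, sub_zero]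
    rcases posDef_or_neg_posSemidef_of_lindblad_eq_zero hirr
      (hτ.1.1.isHermitian.sub hρ.1.1.isHermitian) hker with h | h
    · exact sub_eq_zero.mp (h.posSemidef.trace_eq_zero_iff.mp htr)
    · exact sub_eq_zero.mp (neg_eq_zero.mp (h.trace_eq_zero_iff.mp (by rw [trace_neg, htr, neg_zero])))
end

section
/- Let c ∈ M_N(ℂ) be the truncated annihilation operator, with entries c(n, m) = √(n+1) if m = n+1 and 0 otherwise (indices 0 ≤ n, m ≤ N−1). Then for every Hermitian matrix H ∈ M_N(ℂ) and every finite family of matrices (V_d) in M_N(ℂ), the Lindblad generator whose Lindblad operators consist of c together with the V_d has a unique steady state: there is exactly one density matrix ρ with 𝓛(ρ) = 0. -/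
open Matrix
open scoped ComplexOrder

/-- The truncated annihilation operator `c`, with `c(n, n+1) = √(n+1)`. -/
noncomputable def annihilationOp (N : ℕ) : Matrix (Fin N) (Fin N) ℂ :=
  Matrix.of fun n m : Fin N =>
    if (m : ℕ) = (n : ℕ) + 1 then (Real.sqrt ((n : ℕ) + 1) : ℂ) else 0

namespace Lindblad

variable {n : Type*} [Fintype n] [DecidableEq n]

lemma exists_posSemidef_sub {ρ : Matrix n n ℂ} (hρ : ρ.IsHermitian) :
    ∃ A B : Matrix n n ℂ, A.PosSemidef ∧ B.PosSemidef ∧ ρ = A - B ∧ A * B = 0 := by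
  have hU : star (hρ.eigenvectorUnitary : Matrix n n ℂ) * hρ.eigenvectorUnitary = 1 := by
    simp
  have hs := hρ.spectral_theorem
  rw [Unitary.conjStarAlgAut_apply] at hs
  generalize (hρ.eigenvectorUnitary : Matrix n n ℂ) = U at hU hs
  have hpos (f : n → ℝ) (hf : 0 ≤ f) :
      (U * diagonal (fun i => (f i : ℂ)) * star U).PosSemidef := by
    refine PosSemidef.mul_mul_conjTranspose_same (posSemidef_diagonal_iff.2 fun i => ?_) U
    exact_mod_cast hf i
  refine ⟨_, _, hpos (fun i => max (hρ.eigenvalues i) 0) fun i => le_max_right _ _,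
    hpos (fun i => max (-hρ.eigenvalues i) 0) fun i => le_max_right _ _, ?_, ?_⟩
  · rw [← sub_mul, ← mul_sub, diagonal_sub]
    conv_lhs => rw [hs]
    congr 3
    funext i
    simp only [Function.comp_apply, Complex.coe_algebraMap, ← Complex.ofReal_sub]
    rcases le_total 0 (hρ.eigenvalues i) with h | h <;> simp [h]
  · calc _ = U * diagonal (fun i => ((max (hρ.eigenvalues i) 0 : ℝ) : ℂ)) * (star U * U) *
          diagonal (fun i => ((max (-hρ.eigenvalues i) 0 : ℝ) : ℂ)) * star U := by noncomm_ring
      _ = 0 := by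
        rw [hU, mul_one, mul_assoc U, diagonal_mul_diagonal]
        have : (fun i => ((max (hρ.eigenvalues i) 0 : ℝ) : ℂ) *
            ((max (-hρ.eigenvalues i) 0 : ℝ) : ℂ)) = 0 := by
          funext i
          rcases le_total 0 (hρ.eigenvalues i) with h | h <;> simp [h]
        rw [this]
        simp

lemma exists_mul_isHermitian {A : Matrix n n ℂ} (hA : A.IsHermitian) :
    ∃ A' : Matrix n n ℂ, A * A' * A = A ∧ (A * A').IsHermitian := by
  have hU : star (hA.eigenvectorUnitary : Matrix n n ℂ) * hA.eigenvectorUnitary = 1 := by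
    simp
  have hs := hA.spectral_theorem
  rw [Unitary.conjStarAlgAut_apply] at hs
  generalize (hA.eigenvectorUnitary : Matrix n n ℂ) = U at hU hs
  generalize hA.eigenvalues = d at hs
  have hmul (x y : n → ℂ) : U * diagonal x * star U * (U * diagonal y * star U) =
      U * diagonal (fun i => x i * y i) * star U := by
    calc _ = U * diagonal x * (star U * U) * diagonal y * star U := by noncomm_ring
      _ = _ := by rw [hU, mul_one, mul_assoc U, diagonal_mul_diagonal]
  subst hs
  refine ⟨U * diagonal (fun i => ((d i)⁻¹ : ℂ)) * star U, ?_, ?_⟩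
  · rw [hmul, hmul]
    congr 3
    funext i
    by_cases h : d i = 0 <;> simp [h]
  · rw [hmul]
    refine isHermitian_mul_mul_conjTranspose U (isHermitian_diagonal_of_self_adjoint _ ?_)
    funext i
    simp

open scoped MatrixOrder in
lemma mul_eq_zero_of_trace_eq_zero {A : Matrix n n ℂ} (hA : A.PosSemidef) {M : Matrix n n ℂ}
    (h : (M * A * Mᴴ).trace = 0) : M * A = 0 := by
  have h0 : M * A * Mᴴ = 0 := (hA.mul_mul_conjTranspose_same M).trace_eq_zero_iff.1 h
  obtain ⟨C, rfl⟩ := CStarAlgebra.nonneg_iff_eq_star_mul_self.1 hA.nonneg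
  rw [star_eq_conjTranspose] at h0 ⊢
  have : (M * Cᴴ) * (M * Cᴴ)ᴴ = 0 := by
    rw [← h0]; simp [mul_assoc]
  rw [← mul_assoc, self_mul_conjTranspose_eq_zero.1 this, zero_mul]

variable {ι : Type*} [Fintype ι] (H : Matrix n n ℂ) (V : ι → Matrix n n ℂ)

/-- The Lindblad generator as a linear map. -/
noncomputable def generator : Matrix n n ℂ →ₗ[ℂ] Matrix n n ℂ where
  toFun := lindblad H V
  map_add' ρ σ := by
    simp only [lindblad, mul_add, add_mul, smul_add, smul_sub, Finset.sum_add_distrib,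
      Finset.sum_sub_distrib]
    abel
  map_smul' a ρ := by
    simp only [lindblad, smul_mul, smul_add, smul_sub, Finset.smul_sum,
      RingHom.id_apply, Finset.sum_add_distrib, Finset.sum_sub_distrib, smul_comm a,
      Matrix.mul_smul, Matrix.smul_mul]

lemma generator_apply (ρ : Matrix n n ℂ) : generator H V ρ = lindblad H V ρ := rfl

lemma trace_lindblad (ρ : Matrix n n ℂ) : (lindblad H V ρ).trace = 0 := by
  have h1 (d : ι) : (V d * ρ * (V d)ᴴ).trace = ((V d)ᴴ * V d * ρ).trace := by
    rw [trace_mul_comm, mul_assoc]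
  have h2 (d : ι) : (ρ * ((V d)ᴴ * V d)).trace = ((V d)ᴴ * V d * ρ).trace := trace_mul_comm _ _
  simp only [lindblad, trace_add, trace_sub, trace_smul, trace_sum, h1, h2, trace_mul_comm H ρ]
  rw [sub_self, smul_zero, zero_add]
  refine Finset.sum_eq_zero fun d _ => ?_
  rw [smul_eq_mul]
  ring

variable {H} in
lemma conjTranspose_lindblad (hH : H.IsHermitian) (ρ : Matrix n n ℂ) :
    (lindblad H V ρ)ᴴ = lindblad H V ρᴴ := by
  simp only [lindblad, conjTranspose_add, conjTranspose_smul, conjTranspose_sub,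
    conjTranspose_sum, conjTranspose_mul, conjTranspose_conjTranspose, hH.eq]
  congr 1
  · simp only [Complex.star_def, map_neg, Complex.conj_I, neg_neg, smul_sub, neg_smul]
    abel
  · refine Finset.sum_congr rfl fun d _ => ?_
    rw [add_comm]
    simp [mul_assoc]

variable {H V}

/-- Compressing `𝓛(A)` by a matrix annihilating `A` leaves only the jump terms. -/
lemma mul_lindblad_mul_self {A M : Matrix n n ℂ} (h : M * A = 0) (h' : A * M = 0) :
    M * lindblad H V A * M = ∑ d, M * V d * A * (V d)ᴴ * M := by
  have e1 (X : Matrix n n ℂ) : M * (X * A) * M = 0 := by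
    rw [mul_assoc, mul_assoc, h', mul_zero, mul_zero]
  have e2 (X : Matrix n n ℂ) : M * (A * X) * M = 0 := by
    rw [← mul_assoc, h, zero_mul, zero_mul]
  simp only [lindblad, mul_add, add_mul, mul_sub, sub_mul, Finset.mul_sum, Finset.sum_mul,
    Matrix.mul_smul, Matrix.smul_mul, e1, e2]
  simp [mul_assoc]

/-- If orthogonal positive semidefinite matrices `A`, `B` satisfy `𝓛(A) = 𝓛(B)`, then both are
stationary and the range of `A` is invariant under the Lindblad operators. -/
theorem lindblad_eq_zero_of_eq (hH : H.IsHermitian) {A B : Matrix n n ℂ} (hA : A.PosSemidef)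
    (hB : B.PosSemidef) (hAB : A * B = 0) (hL : lindblad H V A = lindblad H V B) :
    lindblad H V A = 0 ∧ ∀ d, ∃ X, V d * A = A * X := by
  obtain ⟨A', hA', hP⟩ := exists_mul_isHermitian hA.1
  obtain ⟨P, hPdef⟩ : ∃ P, P = A * A' := ⟨_, rfl⟩
  rw [← hPdef] at hA' hP
  have hP' : P = A'ᴴ * A := by
    rw [← hP.eq, hPdef, conjTranspose_mul, hA.1.eq]
  have hAP : A * P = A := by
    have := congrArg conjTranspose hA'
    rwa [conjTranspose_mul, hA.1.eq, hP.eq] at this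
  have hPB : P * B = 0 := by rw [hP', mul_assoc, hAB, mul_zero]
  have hBP : B * P = 0 := by
    have := congrArg conjTranspose hPB
    rwa [conjTranspose_mul, hB.1.eq, hP.eq, conjTranspose_zero] at this
  have hPP : P * P = P := by
    conv_lhs => rw [hPdef, ← mul_assoc, ← hPdef, hA', ← hPdef]
  have hQ : (1 - P).IsHermitian := isHermitian_one.sub hP
  have hQA : (1 - P) * A = 0 := by rw [sub_mul, one_mul, hA', sub_self]
  have hAQ : A * (1 - P) = 0 := by rw [mul_sub, mul_one, hAP, sub_self]
  have hBQ : B * (1 - P) = B := by rw [mul_sub, mul_one, hBP, sub_zero]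
  have hQQ : (1 - P) * (1 - P) = 1 - P := by rw [mul_sub, mul_one, sub_mul, one_mul, hPP]; simp
  have htr : ((1 - P) * lindblad H V A * (1 - P)).trace + (P * lindblad H V B * P).trace = 0 := by
    rw [trace_mul_comm, ← mul_assoc, hQQ, trace_mul_comm (_ * _) P, ← mul_assoc, hPP, ← hL,
      ← trace_add, ← add_mul, sub_add_cancel, one_mul, trace_lindblad]
  have hposQ (d : ι) : 0 ≤ ((1 - P) * V d * A * (V d)ᴴ * (1 - P)).trace := by
    have := (hA.mul_mul_conjTranspose_same ((1 - P) * V d)).trace_nonneg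
    rwa [conjTranspose_mul, hQ.eq, ← mul_assoc] at this
  have hposP (d : ι) : 0 ≤ (P * V d * B * (V d)ᴴ * P).trace := by
    have := (hB.mul_mul_conjTranspose_same (P * V d)).trace_nonneg
    rwa [conjTranspose_mul, hP.eq, ← mul_assoc] at this
  have hLQ := mul_lindblad_mul_self (H := H) (V := V) hQA hAQ
  have hLP := mul_lindblad_mul_self (H := H) (V := V) hPB hBP
  rw [hLQ, hLP, trace_sum, trace_sum, add_eq_zero_iff_of_nonneg
    (Finset.sum_nonneg fun d _ => hposQ d) (Finset.sum_nonneg fun d _ => hposP d),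
    Finset.sum_eq_zero_iff_of_nonneg fun d _ => hposQ d,
    Finset.sum_eq_zero_iff_of_nonneg fun d _ => hposP d] at htr
  have hQVA (d : ι) : (1 - P) * V d * A = 0 := by
    refine mul_eq_zero_of_trace_eq_zero hA ?_
    rw [conjTranspose_mul, hQ.eq, ← mul_assoc]
    exact htr.1 d (Finset.mem_univ d)
  have hPVB (d : ι) : P * V d * B = 0 := by
    refine mul_eq_zero_of_trace_eq_zero hB ?_
    rw [conjTranspose_mul, hP.eq, ← mul_assoc]
    exact htr.2 d (Finset.mem_univ d)
  have hVA (d : ι) : V d * A = P * V d * A := by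
    have := hQVA d
    rwa [sub_mul, sub_mul, one_mul, sub_eq_zero] at this
  refine ⟨?_, fun d => ⟨A' * V d * A, by rw [hVA, hPdef]; simp only [mul_assoc]⟩⟩
  have hAVQ (d : ι) : A * (V d)ᴴ * (1 - P) = 0 := by
    have := congrArg conjTranspose (hQVA d)
    rwa [conjTranspose_mul, conjTranspose_mul, hA.1.eq, hQ.eq, conjTranspose_zero,
      ← mul_assoc] at this
  have hVB (d : ι) : V d * B = (1 - P) * (V d * B) := by
    rw [sub_mul, one_mul, ← mul_assoc P, hPVB, sub_zero]
  have hAVVB (d : ι) : A * ((V d)ᴴ * V d * B) = 0 := by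
    rw [mul_assoc, hVB, ← mul_assoc, ← mul_assoc, hAVQ, zero_mul]
  have hPVVB (d : ι) : P * ((V d)ᴴ * V d * B) = 0 := by
    rw [hP', mul_assoc, hAVVB, mul_zero]
  have hPLBQ : P * lindblad H V B * (1 - P) = -Complex.I • (P * H * B) := by
    have e1 (X : Matrix n n ℂ) : P * (X * B) * (1 - P) = P * (X * B) := by
      rw [mul_assoc, mul_assoc, hBQ]
    have e2 (X : Matrix n n ℂ) : P * (B * X) * (1 - P) = 0 := by
      rw [← mul_assoc, hPB, zero_mul, zero_mul]
    have e3 (d : ι) : P * (V d * B * (V d)ᴴ) * (1 - P) = 0 := by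
      rw [← mul_assoc, ← mul_assoc, hPVB, zero_mul, zero_mul]
    rw [lindblad, mul_add, add_mul, Finset.mul_sum, Finset.sum_mul, Finset.sum_eq_zero, add_zero,
      Matrix.mul_smul, Matrix.smul_mul, mul_sub P, sub_mul (P * _), e1, e2, sub_zero, mul_assoc]
    intro d _
    rw [mul_sub P, sub_mul (P * _), e3, Matrix.mul_smul, Matrix.smul_mul, mul_add, add_mul, e1, e2, hPVVB]
    simp
  have hQB : (1 - P) * B = B := by rw [sub_mul, one_mul, hPB, sub_zero]
  have hPLAB : P * lindblad H V A * B = Complex.I • (A * H * B) := by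
    have e1 (X : Matrix n n ℂ) : P * (X * A) * B = 0 := by
      rw [mul_assoc, mul_assoc, hAB, mul_zero, mul_zero]
    have e2 (X : Matrix n n ℂ) : P * (A * X) * B = A * X * B := by
      rw [← mul_assoc, hA']
    have e3 (d : ι) : P * (V d * A * (V d)ᴴ) * B = 0 := by
      rw [← hQB, ← mul_assoc, ← mul_assoc, ← mul_assoc, ← hVA, mul_assoc (V d), mul_assoc (V d),
        hAVQ, mul_zero, zero_mul]
    rw [lindblad, mul_add, add_mul, Finset.mul_sum, Finset.sum_mul, Finset.sum_eq_zero, add_zero,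
      Matrix.mul_smul, Matrix.smul_mul, mul_sub, sub_mul, e1, e2, zero_sub, smul_neg, neg_smul,
      neg_neg]
    intro d _
    rw [mul_sub, sub_mul, e3, Matrix.mul_smul, Matrix.smul_mul, mul_add, add_mul, e1, e2,
      mul_assoc A, hAVVB]
    simp
  have hb : A * (P * H * B) + P * H * B * B = 0 := by
    have h1 : P * lindblad H V B * (1 - P) * B = P * lindblad H V A * B := by
      rw [mul_assoc _ _ B, hQB, hL]
    rw [hPLBQ, hPLAB, Matrix.smul_mul, neg_smul, neg_eq_iff_add_eq_zero, ← smul_add] at h1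
    have h2 := (smul_eq_zero.1 h1).resolve_left Complex.I_ne_zero
    rw [← mul_assoc, ← mul_assoc, hAP, add_comm]
    exact h2
  have hPHB : P * H * B = 0 := by
    have hPb : P * (P * H * B) = P * H * B := by rw [← mul_assoc, ← mul_assoc, hPP]
    generalize P * H * B = b at hb hPb
    have h1 : (bᴴ * A * bᴴᴴ).trace + (b * B * bᴴ).trace = 0 := by
      rw [conjTranspose_conjTranspose, trace_mul_comm _ bᴴ, ← trace_add, mul_assoc, ← mul_add, hb,
        mul_zero, trace_zero]
    rw [add_eq_zero_iff_of_nonneg (hA.mul_mul_conjTranspose_same bᴴ).trace_nonneg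
      (hB.mul_mul_conjTranspose_same b).trace_nonneg] at h1
    have h2 := congrArg conjTranspose (mul_eq_zero_of_trace_eq_zero hA h1.1)
    rw [conjTranspose_mul, hA.1.eq, conjTranspose_conjTranspose, conjTranspose_zero] at h2
    rw [← hPb, hP', mul_assoc, h2, mul_zero]
  have hPXQ : P * lindblad H V A * (1 - P) = 0 := by rw [hL, hPLBQ, hPHB, smul_zero]
  have hQXP : (1 - P) * lindblad H V A * P = 0 := by
    have := congrArg conjTranspose hPXQ
    rwa [conjTranspose_mul, conjTranspose_mul, conjTranspose_lindblad V hH, hA.1.eq, hP.eq, hQ.eq,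
      conjTranspose_zero, ← mul_assoc] at this
  have hQXQ : (1 - P) * lindblad H V A * (1 - P) = 0 := by
    rw [hLQ]
    exact Finset.sum_eq_zero fun d _ => by rw [hQVA, zero_mul, zero_mul]
  have hPXP : P * lindblad H V A * P = 0 := by
    rw [hL, hLP]
    exact Finset.sum_eq_zero fun d _ => by rw [hPVB, zero_mul, zero_mul]
  calc lindblad H V A = P * lindblad H V A * P + P * lindblad H V A * (1 - P) +
        ((1 - P) * lindblad H V A * P + (1 - P) * lindblad H V A * (1 - P)) := by noncomm_ring
    _ = 0 := by rw [hPXP, hPXQ, hQXP, hQXQ]; simp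

lemma exists_isHermitian_lindblad_eq_zero [Nonempty n] (hH : H.IsHermitian) :
    ∃ ρ : Matrix n n ℂ, ρ.IsHermitian ∧ ρ ≠ 0 ∧ lindblad H V ρ = 0 := by
  have hinj : ¬ Function.Injective (generator H V) := by
    intro h
    obtain ⟨Y, hY⟩ := LinearMap.injective_iff_surjective.1 h 1
    have := trace_lindblad H V Y
    rw [← generator_apply, hY, trace_one] at this
    simp at this
  rw [injective_iff_map_eq_zero] at hinj
  push Not at hinj
  obtain ⟨Y, hY, hY0⟩ := hinj
  have hY' : generator H V Yᴴ = 0 := by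
    rw [generator_apply, ← conjTranspose_lindblad V hH, ← generator_apply, hY, conjTranspose_zero]
  by_cases h : Y + Yᴴ = 0
  · refine ⟨Complex.I • Y, ?_, smul_ne_zero Complex.I_ne_zero hY0, ?_⟩
    · rw [IsHermitian, conjTranspose_smul, eq_neg_of_add_eq_zero_right h]
      simp
    · rw [← generator_apply, map_smul, hY, smul_zero]
  · refine ⟨Y + Yᴴ, isHermitian_add_transpose_self Y, h, ?_⟩
    rw [← generator_apply, map_add, hY, hY', add_zero]

theorem exists_isSteadyState [Nonempty n] (hH : H.IsHermitian) : ∃ ρ, IsSteadyState H V ρ := by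
  suffices h : ∃ A : Matrix n n ℂ, A.PosSemidef ∧ A ≠ 0 ∧ lindblad H V A = 0 by
    obtain ⟨A, hA, hA0, hLA⟩ := h
    have ht : A.trace ≠ 0 := fun h => hA0 (hA.trace_eq_zero_iff.1 h)
    refine ⟨A.trace⁻¹ • A, ⟨hA.smul (inv_nonneg.2 hA.trace_nonneg), ?_⟩, ?_⟩
    · rw [trace_smul, smul_eq_mul, inv_mul_cancel₀ ht]
    · rw [← generator_apply, map_smul, generator_apply, hLA, smul_zero]
  obtain ⟨ρ, hρ, hρ0, hL⟩ := exists_isHermitian_lindblad_eq_zero (V := V) hH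
  obtain ⟨A, B, hA, hB, rfl, hAB⟩ := exists_posSemidef_sub hρ
  have hLAB : lindblad H V A = lindblad H V B := by
    rwa [← generator_apply, map_sub, sub_eq_zero] at hL
  have hLA := (lindblad_eq_zero_of_eq hH hA hB hAB hLAB).1
  by_cases hA0 : A = 0
  · refine ⟨B, hB, ?_, hLAB ▸ hLA⟩
    rintro rfl
    exact hρ0 (by rw [hA0, sub_zero])
  · exact ⟨A, hA, hA0, hLA⟩

section Annihilation

variable {N : ℕ}

lemma annihilationOp_mul_apply (M : Matrix (Fin N) (Fin N) ℂ) (i i' j : Fin N)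
    (h : (i' : ℕ) = i + 1) :
    (annihilationOp N * M) i j = (Real.sqrt ((i : ℕ) + 1) : ℂ) * M i' j := by
  rw [mul_apply, Finset.sum_eq_single i']
  · simp [annihilationOp, h]
  · intro k _ hk
    have : (k : ℕ) ≠ i + 1 := fun hk' => hk (Fin.ext (hk'.trans h.symm))
    simp [annihilationOp, this]
  · simp

lemma annihilationOp_mul_apply_last (M : Matrix (Fin N) (Fin N) ℂ) (i j : Fin N)
    (h : N ≤ (i : ℕ) + 1) : (annihilationOp N * M) i j = 0 := by
  rw [mul_apply]
  refine Finset.sum_eq_zero fun k _ => ?_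
  have : (k : ℕ) ≠ i + 1 := by omega
  simp [annihilationOp, this]

lemma annihilationOp_pow_mul_apply (M : Matrix (Fin N) (Fin N) ℂ) (k : ℕ) (i j : Fin N)
    (h : N ≤ (i : ℕ) + k) : (annihilationOp N ^ k * M) i j = 0 := by
  induction k generalizing i with
  | zero => omega
  | succ k ih =>
    rw [pow_succ', mul_assoc]
    by_cases hi : N ≤ (i : ℕ) + 1
    · exact annihilationOp_mul_apply_last _ i j hi
    · rw [annihilationOp_mul_apply _ i ⟨i + 1, by omega⟩ j rfl, ih _ (by simp; omega), mul_zero]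

/-- A nonzero matrix whose range is invariant under the annihilation operator has a vector in its
range which is a nonzero multiple of the first basis vector. -/
lemma exists_mul_supported_of_annihilationOp_mul (hN : 1 ≤ N) {A X : Matrix (Fin N) (Fin N) ℂ}
    (hA : A ≠ 0) (hX : annihilationOp N * A = A * X) :
    ∃ Y : Matrix (Fin N) (Fin N) ℂ, (∀ i j, i ≠ ⟨0, hN⟩ → (A * Y) i j = 0) ∧
      ∃ j, (A * Y) ⟨0, hN⟩ j ≠ 0 := by
  have hpow (k : ℕ) : annihilationOp N ^ k * A = A * X ^ k := by
    induction k with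
    | zero => simp
    | succ k ih => rw [pow_succ, mul_assoc, hX, ← mul_assoc, ih, mul_assoc, ← pow_succ]
  have hex : ∃ k, annihilationOp N ^ k * A = 0 :=
    ⟨N, ext fun i j => annihilationOp_pow_mul_apply A N i j (by omega)⟩
  classical
  have hfind := Nat.find_spec hex
  obtain ⟨k, hk⟩ : ∃ k, Nat.find hex = k + 1 := by
    refine Nat.exists_eq_succ_of_ne_zero fun h => hA ?_
    rwa [h, pow_zero, one_mul] at hfind
  have hne : annihilationOp N ^ k * A ≠ 0 := Nat.find_min hex (by omega)
  rw [hk, pow_succ', mul_assoc] at hfind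
  rw [hpow] at hne hfind
  have hrow : ∀ i j, i ≠ ⟨0, hN⟩ → (A * X ^ k) i j = 0 := by
    intro i j hi
    have hi' : (i : ℕ) ≠ 0 := fun h => hi (Fin.ext h)
    have h := annihilationOp_mul_apply (A * X ^ k) ⟨i - 1, by omega⟩ i j (by simp; omega)
    rw [hfind, Matrix.zero_apply, eq_comm, mul_eq_zero, Complex.ofReal_eq_zero] at h
    exact h.resolve_left (by positivity)
  refine ⟨X ^ k, hrow, ?_⟩
  by_contra! h
  refine hne (ext fun i j => ?_)
  by_cases hi : i = ⟨0, hN⟩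
  · exact hi ▸ h j
  · exact hrow i j hi

lemma mul_ne_zero_of_annihilationOp_mul (hN : 1 ≤ N) {A B X Y : Matrix (Fin N) (Fin N) ℂ}
    (hA : A ≠ 0) (hB : B ≠ 0) (hX : annihilationOp N * A = A * X)
    (hY : annihilationOp N * B = B * Y) : Aᴴ * B ≠ 0 := by
  obtain ⟨S, hS, j, hj⟩ := exists_mul_supported_of_annihilationOp_mul hN hA hX
  obtain ⟨T, hT, l, hl⟩ := exists_mul_supported_of_annihilationOp_mul hN hB hY
  intro h
  have h0 : (A * S)ᴴ * (B * T) = 0 := by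
    rw [conjTranspose_mul, mul_assoc, ← mul_assoc Aᴴ, h, zero_mul, mul_zero]
  have h1 := congrFun (congrFun h0 j) l
  rw [mul_apply, Finset.sum_eq_single ⟨0, hN⟩ (fun i _ hi => by rw [hT i l hi, mul_zero])
    (by simp), conjTranspose_apply, Matrix.zero_apply] at h1
  exact mul_ne_zero (star_ne_zero.2 hj) hl h1

end Annihilation

end Lindblad

/-- If the Lindblad operators include the annihilation operator, the steady state is
unique, regardless of the Hamiltonian and the other Lindblad operators. -/
theorem unique_steady_state_with_annihilation (N : ℕ) (hN : 1 ≤ N)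
    (H : Matrix (Fin N) (Fin N) ℂ) (hH : H.IsHermitian)
    {ι : Type*} [Fintype ι] (V : ι → Matrix (Fin N) (Fin N) ℂ) :
    ∃! ρ : Matrix (Fin N) (Fin N) ℂ,
      IsSteadyState H (fun o : Option ι => o.elim (annihilationOp N) V) ρ := by
  have : Nonempty (Fin N) := ⟨⟨0, hN⟩⟩
  obtain ⟨ρ, hρ⟩ := Lindblad.exists_isSteadyState
    (V := fun o : Option ι => o.elim (annihilationOp N) V) hH
  refine ⟨ρ, hρ, fun σ hσ => ?_⟩
  obtain ⟨A, B, hA, hB, hsub, hAB⟩ :=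
    Lindblad.exists_posSemidef_sub (hσ.1.1.isHermitian.sub hρ.1.1.isHermitian)
  have hBA : B * A = 0 := by
    have := congrArg conjTranspose hAB
    rwa [conjTranspose_mul, hA.1.eq, hB.1.eq, conjTranspose_zero] at this
  have hL : lindblad H (fun o : Option ι => o.elim (annihilationOp N) V) A =
      lindblad H (fun o : Option ι => o.elim (annihilationOp N) V) B := by
    rw [← sub_eq_zero, ← Lindblad.generator_apply, ← Lindblad.generator_apply, ← map_sub, ← hsub,
      map_sub, Lindblad.generator_apply, Lindblad.generator_apply, hσ.2, hρ.2, sub_zero]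
  obtain ⟨X, hX⟩ := (Lindblad.lindblad_eq_zero_of_eq hH hA hB hAB hL).2 none
  obtain ⟨Y, hY⟩ := (Lindblad.lindblad_eq_zero_of_eq hH hB hA hBA hL.symm).2 none
  have htr : A.trace = B.trace := by
    rw [← sub_eq_zero, ← trace_sub, ← hsub, trace_sub, hσ.1.2, hρ.1.2, sub_self]
  have hA0 : A = 0 := by
    by_contra hA0
    have hB0 : B ≠ 0 := by
      rintro rfl
      exact hA0 (hA.trace_eq_zero_iff.1 (by rw [htr, trace_zero]))
    exact Lindblad.mul_ne_zero_of_annihilationOp_mul hN hA0 hB0 hX hY (by rw [hA.1.eq, hAB])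
  have hB0 : B = 0 := hB.trace_eq_zero_iff.1 (by rw [← htr, hA0, trace_zero])
  rw [hA0, hB0, sub_zero] at hsub
  exact sub_eq_zero.1 hsub
end
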